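/- For a prime power q ≥ 2, Σ_{n≥0} 1/|AGL(n,q)| = Π_{m≥1} 1/((1-q^(-(5m-3)))(1-q^(-(5m-2)))), where AGL(n,q) is the affine general linear group of order qⁿ·|GL(n,q)| and |AGL(0,q)| = 1. -/

import Mathlib

open Finset Filter Topology

/-- The finite `q`-Pochhammer symbol `(x; x)_n = ∏_{i=1}^n (1 - x^i)`. -/
noncomputable def qPoch (x : ℝ) (n : ℕ) : ℝ := ∏ i ∈ range n, (1 - x ^ (i + 1))

/-- The Gaussian binomial coefficient evaluated at a real number. -/
noncomputable def gaussBinom (x : ℝ) : ℕ → ℕ → ℝ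
  | _, 0 => 1
  | 0, _ + 1 => 0
  | n + 1, k + 1 => gaussBinom x n k + x ^ (k + 1) * gaussBinom x n (k + 1)

/-- The sequence paired with `n ↦ if n = 0 then 1 else 0` by the unit Bailey pair relative to `x`. -/
noncomputable def unitBaileySeq (x : ℝ) (j : ℕ) : ℝ :=
  (-1) ^ j * x ^ (j.choose 2) * (1 - x ^ (2 * j + 1))

lemma qPoch_zero (x : ℝ) : qPoch x 0 = 1 := by simp [qPoch]

lemma qPoch_succ (x : ℝ) (n : ℕ) : qPoch x (n + 1) = qPoch x n * (1 - x ^ (n + 1)) :=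
  prod_range_succ _ _

lemma one_sub_pow_succ_pos {x : ℝ} (hx0 : 0 < x) (hx1 : x < 1) (n : ℕ) :
    0 < 1 - x ^ (n + 1) :=
  sub_pos.2 (pow_lt_one₀ hx0.le hx1 n.succ_ne_zero)

lemma qPoch_pos {x : ℝ} (hx0 : 0 < x) (hx1 : x < 1) (n : ℕ) : 0 < qPoch x n :=
  prod_pos fun i _ => one_sub_pow_succ_pos hx0 hx1 i

lemma gaussBinom_zero_right (x : ℝ) (n : ℕ) : gaussBinom x n 0 = 1 := by
  cases n <;> rfl

lemma gaussBinom_succ_succ (x : ℝ) (n k : ℕ) :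
    gaussBinom x (n + 1) (k + 1) = gaussBinom x n k + x ^ (k + 1) * gaussBinom x n (k + 1) :=
  rfl

lemma gaussBinom_eq_zero (x : ℝ) {n k : ℕ} (h : n < k) : gaussBinom x n k = 0 := by
  induction n generalizing k with
  | zero =>
    cases k with
    | zero => omega
    | succ k => rfl
  | succ n ih =>
    cases k with
    | zero => omega
    | succ k => rw [gaussBinom_succ_succ, ih (by omega), ih (by omega)]; simp

lemma gaussBinom_mul_qPoch (x : ℝ) (k d : ℕ) :
    gaussBinom x (k + d) k * (qPoch x k * qPoch x d) = qPoch x (k + d) := by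
  induction k generalizing d with
  | zero => simp [gaussBinom_zero_right, qPoch_zero]
  | succ k ihk =>
    induction d with
    | zero =>
      have h := ihk 0
      rw [Nat.add_zero] at h ⊢
      rw [gaussBinom_succ_succ, gaussBinom_eq_zero x k.lt_succ_self, qPoch_succ]
      linear_combination (1 - x ^ (k + 1)) * h
    | succ d ihd =>
      have h := ihk (d + 1)
      rw [show k + (d + 1) = k + 1 + d by ring] at h
      rw [← add_assoc, gaussBinom_succ_succ, qPoch_succ x (k + 1 + d), qPoch_succ x k,
        qPoch_succ x d]
      rw [qPoch_succ x k] at ihd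
      rw [qPoch_succ x d] at h
      linear_combination (1 - x ^ (k + 1)) * h + x ^ (k + 1) * (1 - x ^ (d + 1)) * ihd

lemma gaussBinom_eq_div {x : ℝ} (hx0 : 0 < x) (hx1 : x < 1) (k d : ℕ) :
    gaussBinom x (k + d) k = qPoch x (k + d) / (qPoch x k * qPoch x d) := by
  rw [eq_div_iff (mul_pos (qPoch_pos hx0 hx1 k) (qPoch_pos hx0 hx1 d)).ne', gaussBinom_mul_qPoch]

/-- The `q`-binomial theorem. -/
lemma prod_one_add_mul_pow (x z : ℝ) (n : ℕ) :
    ∏ i ∈ range n, (1 + z * x ^ i) =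
      ∑ k ∈ range (n + 1), x ^ (k.choose 2) * z ^ k * gaussBinom x n k := by
  induction n generalizing z with
  | zero => simp [gaussBinom_zero_right]
  | succ n ih =>
    have h : ∀ i, 1 + z * x ^ (i + 1) = 1 + z * x * x ^ i := fun i => by ring
    rw [prod_range_succ', sum_range_succ']
    simp only [h, ih, gaussBinom_succ_succ, gaussBinom_zero_right, mul_add, sum_add_distrib]
    have h2 : ∑ k ∈ range (n + 1), x ^ (k.choose 2) * (z * x) ^ k * gaussBinom x n k =
        ∑ k ∈ range (n + 1), x ^ ((k + 1).choose 2) * z ^ (k + 1) *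
          (x ^ (k + 1) * gaussBinom x n (k + 1)) + 1 := by
      rw [sum_range_succ', sum_range_succ _ n, gaussBinom_eq_zero x n.lt_succ_self]
      simp only [gaussBinom_zero_right, mul_zero, add_zero]
      congr 1
      · exact sum_congr rfl fun k _ => by rw [mul_pow]; ring
      · simp
    have h3 : (∑ k ∈ range (n + 1), x ^ (k.choose 2) * (z * x) ^ k * gaussBinom x n k) * z =
        ∑ k ∈ range (n + 1), x ^ ((k + 1).choose 2) * z ^ (k + 1) * gaussBinom x n k := by
      rw [sum_mul]
      refine sum_congr rfl fun k _ => ?_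
      rw [Nat.choose_succ_succ' k 1, Nat.choose_one_right, mul_pow]
      ring
    simp only [pow_zero, mul_one]
    rw [h3, h2]
    simp
    ring

lemma sum_gaussBinom_div_qPoch {x : ℝ} (hx0 : 0 < x) (hx1 : x < 1) (n c : ℕ) :
    ∑ k ∈ range (n + 1), x ^ (k * (k + c)) * gaussBinom x n k / qPoch x (k + c) =
      1 / qPoch x (n + c) := by
  induction n generalizing c with
  | zero => simp [gaussBinom_zero_right]
  | succ n ih =>
    rw [show n + 1 + c = n + (c + 1) by ring, ← ih (c + 1), sum_range_succ']
    have key : ∀ k, x ^ ((k + 1) * (k + 1 + c)) * gaussBinom x (n + 1) (k + 1) /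
          qPoch x (k + 1 + c) =
        x ^ (k * (k + (c + 1))) * gaussBinom x n k / qPoch x (k + (c + 1)) +
        (x ^ ((k + 1) * (k + 1 + c)) * x ^ (k + 1) * gaussBinom x n (k + 1) /
            qPoch x (k + 1 + c) -
          x ^ (k * (k + c)) * x ^ k * gaussBinom x n k / qPoch x (k + c)) +
        (x ^ (k * (k + c)) * x ^ k * gaussBinom x n k / qPoch x (k + c)
          - x ^ (k * (k + (c + 1))) * gaussBinom x n k / qPoch x (k + (c + 1))
          + x ^ ((k + 1) * (k + 1 + c)) * gaussBinom x n k / qPoch x (k + 1 + c)) := by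
      intro k
      rw [gaussBinom_succ_succ]
      ring
    have cancel : ∀ k, x ^ (k * (k + c)) * x ^ k * gaussBinom x n k / qPoch x (k + c)
          - x ^ (k * (k + (c + 1))) * gaussBinom x n k / qPoch x (k + (c + 1))
          + x ^ ((k + 1) * (k + 1 + c)) * gaussBinom x n k / qPoch x (k + 1 + c) = 0 := by
      intro k
      have h1 := (qPoch_pos hx0 hx1 (k + c)).ne'
      have h2 := (one_sub_pow_succ_pos hx0 hx1 (k + c)).ne'
      rw [show k + 1 + c = k + c + 1 by ring, show k + (c + 1) = k + c + 1 by ring, qPoch_succ]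
      field_simp
      ring
    simp only [key, cancel, add_zero]
    rw [sum_add_distrib, sum_range_sub
      (fun k => x ^ (k * (k + c)) * x ^ k * gaussBinom x n k / qPoch x (k + c)),
      gaussBinom_eq_zero x n.lt_succ_self]
    simp [gaussBinom_zero_right]

/-- A limiting case of the `q`-Vandermonde summation. -/
lemma sum_pow_div_qPoch {x : ℝ} (hx0 : 0 < x) (hx1 : x < 1) (n c : ℕ) :
    ∑ k ∈ range (n + 1), x ^ (k * (k + c)) / (qPoch x (n - k) * qPoch x k * qPoch x (k + c)) =
      1 / (qPoch x n * qPoch x (n + c)) := by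
  have h := sum_gaussBinom_div_qPoch hx0 hx1 n c
  rw [mul_comm (qPoch x n) (qPoch x (n + c)), ← div_div, ← h, sum_div]
  refine sum_congr rfl fun k hk => ?_
  obtain ⟨d, rfl⟩ := Nat.exists_eq_add_of_le (mem_range_succ_iff.1 hk)
  rw [gaussBinom_eq_div hx0 hx1, Nat.add_sub_cancel_left]
  have h1 := (qPoch_pos hx0 hx1 (k + d)).ne'
  have h2 := (qPoch_pos hx0 hx1 k).ne'
  have h3 := (qPoch_pos hx0 hx1 d).ne'
  have h4 := (qPoch_pos hx0 hx1 (k + c)).ne'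
  field_simp

/-- Bailey's lemma relative to `x`, in the limiting case of infinite parameters. -/
lemma bailey_lemma {x : ℝ} (hx0 : 0 < x) (hx1 : x < 1) (α : ℕ → ℝ) (N : ℕ) :
    ∑ s ∈ range (N + 1), x ^ (s * (s + 1)) / qPoch x (N - s) *
        ∑ j ∈ range (s + 1), α j / (qPoch x (s - j) * qPoch x (s + j + 1)) =
      ∑ j ∈ range (N + 1), x ^ (j * (j + 1)) * α j / (qPoch x (N - j) * qPoch x (N + j + 1)) := by
  simp only [mul_sum]
  rw [sum_comm' (t' := range (N + 1)) (s' := fun j => Ico j (N + 1))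
    (by intro s j; simp only [mem_range, mem_Ico]; omega)]
  refine sum_congr rfl fun j hj => ?_
  obtain ⟨d, rfl⟩ := Nat.exists_eq_add_of_le (mem_range_succ_iff.1 hj)
  have h := sum_pow_div_qPoch hx0 hx1 d (2 * j + 1)
  rw [sum_Ico_eq_sum_range, show j + d + 1 - j = d + 1 by omega, Nat.add_sub_cancel_left,
    show j + d + j + 1 = d + (2 * j + 1) by ring, div_eq_mul_one_div, ← h, mul_sum]
  refine sum_congr rfl fun k hk => ?_
  rw [Nat.add_sub_cancel_left, show j + d - (j + k) = d - k by omega,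
    show j + k + j + 1 = k + (2 * j + 1) by ring,
    show (j + k) * (j + k + 1) = j * (j + 1) + k * (k + (2 * j + 1)) by ring, pow_add]
  field_simp

lemma sum_unitBaileySeq_range {x : ℝ} (hx0 : 0 < x) (hx1 : x < 1) {n J : ℕ} (hn : 0 < n)
    (hJ : J ≤ n) :
    ∑ j ∈ range (J + 1), unitBaileySeq x j / (qPoch x (n - j) * qPoch x (n + j + 1)) =
      (-1) ^ J * x ^ ((J + 1).choose 2) * (1 - x ^ (J + 1)) * (1 - x ^ (n - J)) /
        (qPoch x (n - J) * qPoch x (n + J + 1) * (1 - x ^ n)) := by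
  have hxn : 1 - x ^ n ≠ 0 := (sub_pos.2 (pow_lt_one₀ hx0.le hx1 hn.ne')).ne'
  induction J with
  | zero =>
    simp [unitBaileySeq]
    rw [mul_div_mul_right _ _ hxn]
  | succ J ih =>
    rw [sum_range_succ, ih (by omega)]
    obtain ⟨d, rfl⟩ := Nat.exists_eq_add_of_le hJ
    rw [show J + 1 + d - J = d + 1 by omega, Nat.add_sub_cancel_left, unitBaileySeq,
      Nat.choose_succ_succ' (J + 1) 1, Nat.choose_one_right,
      show J + 1 + d + (J + 1) + 1 = J + 1 + d + J + 1 + 1 by ring,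
      qPoch_succ x d, qPoch_succ x (J + 1 + d + J + 1)]
    have h1 := (qPoch_pos hx0 hx1 d).ne'
    have h2 := (qPoch_pos hx0 hx1 (J + 1 + d + J + 1)).ne'
    have h3 := (one_sub_pow_succ_pos hx0 hx1 d).ne'
    have h4 := (one_sub_pow_succ_pos hx0 hx1 (J + 1 + d + J + 1)).ne'
    field_simp
    ring

lemma sum_unitBaileySeq {x : ℝ} (hx0 : 0 < x) (hx1 : x < 1) (n : ℕ) :
    ∑ j ∈ range (n + 1), unitBaileySeq x j / (qPoch x (n - j) * qPoch x (n + j + 1)) =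
      if n = 0 then 1 else 0 := by
  split_ifs with h
  · subst h
    have h1 : 1 - x ≠ 0 := by linarith
    simp [unitBaileySeq, qPoch, h1]
  · rw [sum_unitBaileySeq_range hx0 hx1 (Nat.pos_of_ne_zero h) le_rfl]
    simp

/-- The finite form of the second Rogers–Ramanujan identity given by two applications of Bailey's
lemma to the unit Bailey pair. -/
lemma sum_pow_div_qPoch_eq_sum_unitBaileySeq {x : ℝ} (hx0 : 0 < x) (hx1 : x < 1) (N : ℕ) :
    ∑ s ∈ range (N + 1), x ^ (s * (s + 1)) / qPoch x s * (1 / qPoch x (N - s)) =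
      ∑ j ∈ range (N + 1), x ^ (2 * (j * (j + 1))) * unitBaileySeq x j *
        (1 / (qPoch x (N - j) * qPoch x (N + j + 1))) := by
  have h1 : ∀ s, ∑ j ∈ range (s + 1),
      x ^ (j * (j + 1)) * unitBaileySeq x j / (qPoch x (s - j) * qPoch x (s + j + 1)) =
        1 / qPoch x s := by
    intro s
    rw [← bailey_lemma hx0 hx1, sum_eq_single 0]
    · rw [sum_unitBaileySeq hx0 hx1]
      simp
    · intro b _ hb
      rw [sum_unitBaileySeq hx0 hx1, if_neg hb, mul_zero]
    · simp
  have h2 := bailey_lemma hx0 hx1 (fun j => x ^ (j * (j + 1)) * unitBaileySeq x j) N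
  simp only [h1] at h2
  calc _ = _ := sum_congr rfl fun s _ => by ring
    _ = _ := h2
    _ = _ := sum_congr rfl fun j _ => by rw [two_mul, pow_add]; ring

lemma two_mul_choose_two_add (n : ℕ) : 2 * n.choose 2 + n = n * n := by
  induction n with
  | zero => rfl
  | succ n ih =>
    rw [Nat.choose_succ_succ' n 1, Nat.choose_one_right]
    linarith

/-- A finite form of the Jacobi triple product identity. -/
lemma sum_unitBaileySeq_div_qPoch_pow_five {x : ℝ} (hx0 : 0 < x) (hx1 : x < 1) (n : ℕ) :
    ∑ j ∈ range (n + 1), x ^ (2 * (j * (j + 1))) * unitBaileySeq x j *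
        (1 / (qPoch (x ^ 5) (n - j) * qPoch (x ^ 5) (n + j + 1))) =
      (∏ i ∈ range n, (1 - x ^ (5 * i + 4))) * (∏ i ∈ range (n + 1), (1 - x ^ (5 * i + 1))) /
        qPoch (x ^ 5) (2 * n + 1) := by
  have hy0 : 0 < x ^ 5 := pow_pos hx0 5
  have hy1 : x ^ 5 < 1 := pow_lt_one₀ hx0.le hx1 (by norm_num)
  have hx : x ≠ 0 := hx0.ne'
  set K : ℝ := (-1) ^ n * x ^ (5 * n.choose 2 + 4 * n) with hK
  have hKsucc : ∀ n : ℕ, (-1 : ℝ) ^ (n + 1) * x ^ (5 * (n + 1).choose 2 + 4 * (n + 1)) =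
      ((-1) ^ n * x ^ (5 * n.choose 2 + 4 * n)) * -x ^ (5 * n + 4) := by
    intro n
    rw [Nat.choose_succ_succ' n 1, Nat.choose_one_right]
    ring
  have hprod : K * ∏ i ∈ range (2 * n + 1), (1 + -(x / (x ^ 5) ^ n) * (x ^ 5) ^ i) =
      (∏ i ∈ range n, (1 - x ^ (5 * i + 4))) * ∏ i ∈ range (n + 1), (1 - x ^ (5 * i + 1)) := by
    rw [show 2 * n + 1 = n + (n + 1) by ring, prod_range_add, ← mul_assoc]
    congr 1
    · rw [← prod_range_reflect]
      have hK' : K = ∏ i ∈ range n, -x ^ (5 * i + 4) := by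
        rw [hK]
        clear_value K
        clear hK
        induction n with
        | zero => simp
        | succ n ih => rw [prod_range_succ, ← ih, hKsucc]
      rw [hK', ← prod_mul_distrib]
      refine prod_congr rfl fun i hi => ?_
      obtain ⟨d, rfl⟩ := Nat.exists_eq_add_of_lt (mem_range.1 hi)
      rw [show i + d + 1 - 1 - i = d by omega]
      field_simp
      ring
    · refine prod_congr rfl fun i _ => ?_
      field_simp
      ring
  have hsplit : ∀ f : ℕ → ℝ, ∑ k ∈ range (2 * n + 1 + 1), f k =
      ∑ j ∈ range (n + 1), (f (n + 1 - 1 - j) + f (n + 1 + j)) := by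
    intro f
    rw [sum_add_distrib, sum_range_reflect, ← sum_range_add]
    congr 2
    ring
  rw [← hprod, prod_one_add_mul_pow, mul_div_assoc, sum_div, mul_sum, hsplit]
  refine sum_congr rfl fun j hj => ?_
  obtain ⟨k, rfl⟩ := Nat.exists_eq_add_of_le' (mem_range_succ_iff.1 hj)
  have hQ := (qPoch_pos hy0 hy1 (2 * (k + j) + 1)).ne'
  have e1 : gaussBinom (x ^ 5) (2 * (k + j) + 1) k = qPoch (x ^ 5) (2 * (k + j) + 1) /
      (qPoch (x ^ 5) k * qPoch (x ^ 5) (k + j + j + 1)) := by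
    rw [show 2 * (k + j) + 1 = k + (k + j + j + 1) by ring, gaussBinom_eq_div hy0 hy1]
  have e2 : gaussBinom (x ^ 5) (2 * (k + j) + 1) (k + j + 1 + j) =
      qPoch (x ^ 5) (2 * (k + j) + 1) /
        (qPoch (x ^ 5) (k + j + j + 1) * qPoch (x ^ 5) k) := by
    rw [show k + j + j + 1 = k + j + 1 + j by ring,
      show 2 * (k + j) + 1 = k + j + 1 + j + k by ring, gaussBinom_eq_div hy0 hy1]
  rw [show k + j + 1 - 1 - j = k by omega, Nat.add_sub_cancel, e1, e2, unitBaileySeq]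
  have hcj := two_mul_choose_two_add j
  have hck := two_mul_choose_two_add k
  have hcn := two_mul_choose_two_add (k + j)
  have hcm := two_mul_choose_two_add (k + j + 1 + j)
  have t1 : K * ((x ^ 5) ^ (k.choose 2) * (-(x / (x ^ 5) ^ (k + j))) ^ k) =
      (-1) ^ j * x ^ (2 * (j * (j + 1)) + j.choose 2) := by
    rw [neg_pow, div_pow, hK, ← pow_mul, ← pow_mul, ← pow_mul]
    have hs : (-1 : ℝ) ^ (k + j) * (-1) ^ k = (-1) ^ j := by
      rw [← pow_add, show k + j + k = 2 * k + j by ring, pow_add, pow_mul]; simp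
    rw [← hs]
    field_simp
    simp only [← pow_add]
    congr 1
    nlinarith
  have t2 : K * ((x ^ 5) ^ ((k + j + 1 + j).choose 2) *
      (-(x / (x ^ 5) ^ (k + j))) ^ (k + j + 1 + j)) =
      -(-1) ^ j * x ^ (2 * (j * (j + 1)) + j.choose 2 + (2 * j + 1)) := by
    rw [neg_pow, div_pow, hK, ← pow_mul, ← pow_mul, ← pow_mul]
    have hs : (-1 : ℝ) ^ (k + j) * (-1) ^ (k + j + 1 + j) = -(-1) ^ j := by
      rw [← pow_add, show k + j + (k + j + 1 + j) = 2 * (k + j) + (j + 1) by ring, pow_add,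
        pow_mul]; simp [pow_succ]
    rw [← hs]
    field_simp
    simp only [← pow_add]
    congr 1
    nlinarith
  have h1 := (qPoch_pos hy0 hy1 k).ne'
  have h2 := (qPoch_pos hy0 hy1 (k + j + j + 1)).ne'
  calc _ = ((-1) ^ j * x ^ (2 * (j * (j + 1)) + j.choose 2) +
        -(-1) ^ j * x ^ (2 * (j * (j + 1)) + j.choose 2 + (2 * j + 1))) *
          (1 / (qPoch (x ^ 5) k * qPoch (x ^ 5) (k + j + j + 1))) := by ring
    _ = _ := by
      rw [← t1, ← t2]
      field_simp


lemma summable_neg_pow_linear {x : ℝ} (hx0 : 0 < x) (hx1 : x < 1) (c d : ℕ) :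
    Summable fun m : ℕ => -x ^ ((c + 1) * m + d) := by
  refine (Summable.of_nonneg_of_le (fun m => (pow_pos hx0 _).le) (fun m => ?_)
    (summable_geometric_of_lt_one hx0.le hx1)).neg
  exact pow_le_pow_of_le_one hx0.le hx1.le (by nlinarith)

lemma multipliable_one_sub_pow_linear {x : ℝ} (hx0 : 0 < x) (hx1 : x < 1) (c d : ℕ) :
    Multipliable fun m : ℕ => 1 - x ^ ((c + 1) * m + d) := by
  simpa only [sub_eq_add_neg] using
    Real.multipliable_one_add_of_summable (summable_neg_pow_linear hx0 hx1 c d)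

lemma tprod_one_sub_pow_linear_ne_zero {x : ℝ} (hx0 : 0 < x) (hx1 : x < 1) (c d : ℕ) :
    ∏' m : ℕ, (1 - x ^ ((c + 1) * m + (d + 1))) ≠ 0 := by
  simp only [sub_eq_add_neg]
  refine tprod_one_add_ne_zero_of_summable (fun m => ?_)
    (summable_neg_pow_linear hx0 hx1 c (d + 1)).norm
  rw [← sub_eq_add_neg, ← add_assoc]
  exact (one_sub_pow_succ_pos hx0 hx1 _).ne'

lemma antitone_qPoch {x : ℝ} (hx0 : 0 < x) (hx1 : x < 1) : Antitone (qPoch x) := by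
  refine antitone_nat_of_succ_le fun n => ?_
  rw [qPoch_succ]
  exact mul_le_of_le_one_right (qPoch_pos hx0 hx1 n).le (by linarith [pow_pos hx0 (n + 1)])

lemma exists_tendsto_qPoch {x : ℝ} (hx0 : 0 < x) (hx1 : x < 1) :
    ∃ P : ℝ, 0 < P ∧ Tendsto (qPoch x) atTop (𝓝 P) := by
  have h := (multipliable_one_sub_pow_linear hx0 hx1 0 1).hasProd.tendsto_prod_nat
  have hne := tprod_one_sub_pow_linear_ne_zero hx0 hx1 0 0
  simp only [zero_add, one_mul] at h hne
  exact ⟨_, lt_of_le_of_ne (ge_of_tendsto' h fun n => (qPoch_pos hx0 hx1 n).le) hne.symm, h⟩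

lemma tendsto_sum_range_mul_of_bounded {a : ℕ → ℝ} {b : ℕ → ℕ → ℝ} {C L : ℝ}
    (ha : Summable fun n => |a n|) (hb : ∀ N n, n ≤ N → |b N n| ≤ C)
    (hlim : ∀ n, Tendsto (fun N => b N n) atTop (𝓝 L)) :
    Tendsto (fun N => ∑ n ∈ range (N + 1), a n * b N n) atTop (𝓝 ((∑' n, a n) * L)) := by
  have h := tendsto_tsum_of_dominated_convergence (𝓕 := atTop)
    (f := fun N n => if n ∈ range (N + 1) then a n * b N n else 0) (g := fun n => a n * L)
    (bound := fun n => |a n| * C) (ha.mul_right C) ?_ ?_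
  · rw [tsum_mul_right] at h
    refine h.congr fun N => ?_
    rw [tsum_eq_sum (s := range (N + 1)) fun n hn => if_neg hn]
    exact sum_congr rfl fun n hn => if_pos hn
  · intro n
    refine ((hlim n).const_mul (a n)).congr' ?_
    filter_upwards [eventually_ge_atTop n] with N hN
    rw [if_pos (mem_range_succ_iff.2 hN)]
  · refine Eventually.of_forall fun N n => ?_
    split_ifs with h
    · rw [Real.norm_eq_abs, abs_mul]
      exact mul_le_mul_of_nonneg_left (hb N n (mem_range_succ_iff.1 h)) (abs_nonneg _)
    · have hC := (abs_nonneg _).trans (hb n n le_rfl)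
      simpa using mul_nonneg (abs_nonneg (a n)) hC

lemma tendsto_sum_mul_inv_qPoch {x P : ℝ} (hx0 : 0 < x) (hx1 : x < 1) (hP : 0 < P)
    (hlim : Tendsto (qPoch x) atTop (𝓝 P)) {a : ℕ → ℝ} (ha : Summable fun n => |a n|) :
    Tendsto (fun N => ∑ n ∈ range (N + 1), a n * (1 / qPoch x (N - n))) atTop
      (𝓝 ((∑' n, a n) * (1 / P))) := by
  refine tendsto_sum_range_mul_of_bounded (C := 1 / P) ha (fun N n _ => ?_) fun n => ?_
  · have h := (antitone_qPoch hx0 hx1).le_of_tendsto hlim (N - n)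
    rw [abs_of_pos (one_div_pos.2 (qPoch_pos hx0 hx1 _))]
    exact one_div_le_one_div_of_le hP h
  · exact tendsto_const_nhds.div (hlim.comp (tendsto_sub_atTop_nat n)) hP.ne'

lemma tendsto_sum_mul_inv_qPoch_mul_qPoch {x P : ℝ} (hx0 : 0 < x) (hx1 : x < 1) (hP : 0 < P)
    (hlim : Tendsto (qPoch x) atTop (𝓝 P)) {a : ℕ → ℝ} (ha : Summable fun n => |a n|) :
    Tendsto (fun N => ∑ n ∈ range (N + 1), a n * (1 / (qPoch x (N - n) * qPoch x (N + n + 1))))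
      atTop (𝓝 ((∑' n, a n) * (1 / (P * P)))) := by
  refine tendsto_sum_range_mul_of_bounded (C := 1 / (P * P)) ha (fun N n _ => ?_) fun n => ?_
  · have h := (antitone_qPoch hx0 hx1).le_of_tendsto hlim
    rw [abs_of_pos (one_div_pos.2 (mul_pos (qPoch_pos hx0 hx1 _) (qPoch_pos hx0 hx1 _)))]
    exact one_div_le_one_div_of_le (mul_pos hP hP) (mul_le_mul (h _) (h _) hP.le
      (qPoch_pos hx0 hx1 _).le)
  · exact tendsto_const_nhds.div ((hlim.comp (tendsto_sub_atTop_nat n)).mul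
      (hlim.comp (tendsto_add_atTop_nat (n + 1)))) (mul_pos hP hP).ne'

lemma qPoch_five_mul (x : ℝ) (n : ℕ) :
    qPoch x (5 * n) = (∏ i ∈ range n, (1 - x ^ (5 * i + 4))) *
      (∏ i ∈ range n, (1 - x ^ (5 * i + 1))) * qPoch (x ^ 5) n *
        ∏ i ∈ range n, ((1 - x ^ (5 * i + 2)) * (1 - x ^ (5 * i + 3))) := by
  induction n with
  | zero => simp [qPoch_zero]
  | succ n ih =>
    rw [show 5 * (n + 1) = 5 * n + 1 + 1 + 1 + 1 + 1 by ring]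
    simp only [qPoch_succ, prod_range_succ, ih, ← pow_mul]
    ring

/-- The second Rogers–Ramanujan identity. -/
theorem rogers_ramanujan_second {x : ℝ} (hx0 : 0 < x) (hx1 : x < 1) :
    ∑' n : ℕ, x ^ (n * (n + 1)) / qPoch x n =
      ∏' m : ℕ, 1 / ((1 - x ^ (5 * m + 2)) * (1 - x ^ (5 * m + 3))) := by
  have hy0 : 0 < x ^ 5 := pow_pos hx0 5
  have hy1 : x ^ 5 < 1 := pow_lt_one₀ hx0.le hx1 (by norm_num)
  obtain ⟨P, hP, hPlim⟩ := exists_tendsto_qPoch hx0 hx1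
  obtain ⟨Q, hQ, hQlim⟩ := exists_tendsto_qPoch hy0 hy1
  have hgeom := summable_geometric_of_lt_one hx0.le hx1
  have hsum1 : Summable fun n => |x ^ (n * (n + 1)) / qPoch x n| := by
    refine Summable.of_nonneg_of_le (fun n => abs_nonneg _) (fun n => ?_) (hgeom.mul_right (1 / P))
    rw [abs_of_pos (div_pos (pow_pos hx0 _) (qPoch_pos hx0 hx1 n)), div_eq_mul_one_div]
    exact mul_le_mul (pow_le_pow_of_le_one hx0.le hx1.le (by nlinarith))
      (one_div_le_one_div_of_le hP ((antitone_qPoch hx0 hx1).le_of_tendsto hPlim n))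
      (one_div_pos.2 (qPoch_pos hx0 hx1 n)).le (pow_pos hx0 _).le
  have hsum2 : Summable fun n => |x ^ (2 * (n * (n + 1))) * unitBaileySeq x n| := by
    refine Summable.of_nonneg_of_le (fun n => abs_nonneg _) (fun n => ?_) hgeom
    have h1 := one_sub_pow_succ_pos hx0 hx1 (2 * n)
    rw [unitBaileySeq, abs_mul, abs_mul, abs_mul, abs_neg_one_pow, one_mul, abs_of_pos h1,
      abs_of_pos (pow_pos hx0 _), abs_of_pos (pow_pos hx0 _), ← mul_assoc, ← pow_add]
    refine (mul_le_of_le_one_right (pow_pos hx0 _).le ?_).trans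
      (pow_le_pow_of_le_one hx0.le hx1.le (by nlinarith))
    linarith [pow_pos hx0 (2 * n + 1)]
  set S := ∑' n : ℕ, x ^ (n * (n + 1)) / qPoch x n
  set A := ∑' n : ℕ, x ^ (2 * (n * (n + 1))) * unitBaileySeq x n
  have hSA : S * P = A := by
    have h := tendsto_sum_mul_inv_qPoch hx0 hx1 hP hPlim hsum1
    simp only [sum_pow_div_qPoch_eq_sum_unitBaileySeq hx0 hx1] at h
    have h' := tendsto_nhds_unique h
      (tendsto_sum_mul_inv_qPoch_mul_qPoch hx0 hx1 hP hPlim hsum2)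
    field_simp at h'
    linarith
  have hmul : Multipliable fun m : ℕ => (1 - x ^ (5 * m + 2)) * (1 - x ^ (5 * m + 3)) :=
    (multipliable_one_sub_pow_linear hx0 hx1 4 2).mul (multipliable_one_sub_pow_linear hx0 hx1 4 3)
  have hne : ∏' m : ℕ, (1 - x ^ (5 * m + 2)) * (1 - x ^ (5 * m + 3)) ≠ 0 := by
    have := (multipliable_one_sub_pow_linear hx0 hx1 4 2).tprod_mul
      (multipliable_one_sub_pow_linear hx0 hx1 4 3)
    rw [this]
    exact mul_ne_zero (tprod_one_sub_pow_linear_ne_zero hx0 hx1 4 1)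
      (tprod_one_sub_pow_linear_ne_zero hx0 hx1 4 2)
  have hRlim := hmul.hasProd.tendsto_prod_nat
  simp only [one_div]
  rw [hmul.tprod_inv₀ hne]
  set R := ∏' m : ℕ, (1 - x ^ (5 * m + 2)) * (1 - x ^ (5 * m + 3))
  have hAR : A * R = P := by
    have h1 := tendsto_sum_mul_inv_qPoch_mul_qPoch hy0 hy1 hQ hQlim hsum2
    simp only [sum_unitBaileySeq_div_qPoch_pow_five hx0 hx1] at h1
    have h2 : Tendsto (fun n : ℕ => 1 - x ^ (5 * n + 1)) atTop (𝓝 (1 - 0)) :=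
      ((tendsto_pow_atTop_nhds_zero_of_lt_one hx0.le hx1).comp
        (tendsto_atTop_mono (fun n => by dsimp; omega) tendsto_id)).const_sub 1
    have h3 : Tendsto (fun n : ℕ => qPoch (x ^ 5) (2 * n + 1)) atTop (𝓝 Q) :=
      hQlim.comp (tendsto_atTop_mono (fun n => by dsimp; omega) tendsto_id)
    have h4 : Tendsto (fun n : ℕ => qPoch x (5 * n)) atTop (𝓝 P) :=
      hPlim.comp (tendsto_atTop_mono (fun n => by dsimp; omega) tendsto_id)
    have h5 := ((h1.mul h3).mul hQlim).mul hRlim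
    have h6 := tendsto_nhds_unique h5 ((h4.mul h2).congr fun n => ?_)
    · field_simp at h6
      linarith
    · have := (qPoch_pos hy0 hy1 (2 * n + 1)).ne'
      rw [qPoch_five_mul, prod_range_succ (fun i => 1 - x ^ (5 * i + 1))]
      field_simp
  refine eq_inv_of_mul_eq_one_left (mul_right_cancel₀ hP.ne' ?_)
  linear_combination R * hSA + hAR

/-- An affine automorphism of a vector space is a linear automorphism followed by a translation. -/
def affineEquivEquivProd (k V : Type*) [Ring k] [AddCommGroup V] [Module k V] :
    (V ≃ᵃ[k] V) ≃ V × (V ≃ₗ[k] V) where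
  toFun e := (e 0, e.linear)
  invFun p := p.2.toAffineEquiv.trans (AffineEquiv.constVAdd k V p.1)
  left_inv e := by
    ext v
    have h := e.map_vadd 0 v
    simp only [vadd_eq_add, add_zero] at h
    simp [h, add_comm]
  right_inv p := by
    ext
    · simp
    · simp only [AffineEquiv.trans, AffineEquiv.constVAdd]
      rfl

lemma card_affineEquiv (F : Type) [Field F] [Fintype F] (n : ℕ) :
    Nat.card ((Fin n → F) ≃ᵃ[F] (Fin n → F)) =
      Fintype.card F ^ n * ∏ i ∈ range n, (Fintype.card F ^ n - Fintype.card F ^ i) := by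
  classical
  rw [Nat.card_congr (affineEquivEquivProd F (Fin n → F)), Nat.card_prod,
    ← Nat.card_congr (Matrix.GeneralLinearGroup.toLin.trans
      (LinearMap.GeneralLinearGroup.generalLinearEquiv F (Fin n → F))).toEquiv,
    Matrix.card_GL_field,
    Fin.prod_univ_eq_prod_range (fun i => Fintype.card F ^ n - Fintype.card F ^ i)]
  simp

lemma one_div_card_affineEquiv (F : Type) [Field F] [Fintype F] (n : ℕ) :
    (1 : ℝ) / Nat.card ((Fin n → F) ≃ᵃ[F] (Fin n → F)) =
      ((Fintype.card F : ℝ)⁻¹) ^ (n * (n + 1)) / qPoch ((Fintype.card F : ℝ)⁻¹) n := by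
  set q := Fintype.card F with hq
  have hq0 : (q : ℝ) ≠ 0 := by
    rw [hq]
    exact_mod_cast Fintype.card_ne_zero
  have hprod : ((∏ i ∈ range n, (q ^ n - q ^ i) : ℕ) : ℝ) =
      (q : ℝ) ^ (n * n) * qPoch ((q : ℝ)⁻¹) n := by
    have hc : ((q : ℝ) ^ n) ^ n = ∏ _i ∈ range n, (q : ℝ) ^ n := by simp
    rw [qPoch, ← prod_range_reflect, pow_mul, hc, ← prod_mul_distrib, Nat.cast_prod]
    refine prod_congr rfl fun i hi => ?_
    obtain ⟨d, rfl⟩ := Nat.exists_eq_add_of_lt (mem_range.1 hi)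
    rw [Nat.cast_sub (Nat.pow_le_pow_right (Nat.pos_of_ne_zero (by exact_mod_cast hq0))
      (by omega)), show i + d + 1 - 1 - i = d by omega]
    push_cast
    rw [inv_pow]
    field_simp
    ring
  rw [card_affineEquiv, ← hq, Nat.cast_mul, hprod, Nat.cast_pow, ← mul_assoc, ← pow_add,
    show n + n * n = n * (n + 1) by ring, inv_pow, one_div, mul_inv, div_eq_mul_inv]


/-- For a prime power `q` (the cardinality of a finite field `Fq`),
`∑_{n≥0} 1/|AGL(n,q)| = ∏_{m≥1} 1/((1-q^{-(5m-3)})(1-q^{-(5m-2)}))`, where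
`AGL(n,q)` is the affine general linear group (the group of invertible affine
self-maps of `Fqⁿ`), of order `qⁿ·|GL(n,q)|`, and `|AGL(0,q)| = 1`. -/
theorem sum_inv_card_AGL (Fq : Type) [Field Fq] [Fintype Fq] [DecidableEq Fq]
    (q : ℕ) (hq : q = Fintype.card Fq) :
    ∑' n : ℕ, (1 : ℝ) / Nat.card ((Fin n → Fq) ≃ᵃ[Fq] (Fin n → Fq)) =
      ∏' m : ℕ, 1 / ((1 - (q : ℝ) ^ (-(5 * ((m : ℤ) + 1) - 3))) *
        (1 - (q : ℝ) ^ (-(5 * ((m : ℤ) + 1) - 2)))) := by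
  have hq1 : (1 : ℝ) < q := by
    rw [hq]
    exact_mod_cast Fintype.one_lt_card
  simp only [one_div_card_affineEquiv, ← hq]
  rw [rogers_ramanujan_second (inv_pos.2 (by linarith)) (inv_lt_one_of_one_lt₀ hq1)]
  refine tprod_congr fun m => ?_
  rw [inv_pow, inv_pow, ← zpow_natCast, ← zpow_natCast, ← zpow_neg, ← zpow_neg]
  congr 4 <;> congr 1 <;> push_cast <;> ring
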